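/- Let G be an interval graph with ℓ maximal cliques, and let K₁, …, K_ℓ and K_{b(1)}, …, K_{b(ℓ)} (where b is a permutation of {1,…,ℓ}) be two different clique paths of G. If there exist indices p and q with 1 ≤ p < q < ℓ such that b(p) = 1 and b(q) = ℓ, then the set (⋃_{j=b(ℓ)}^{ℓ} K_j ∪ ⋃_{i=q}^{ℓ} K_{b(i)}) \ (K_{b(ℓ)} ∩ K_ℓ) is a nontrivial module of G. -/

import Mathlib

open SimpleGraph

/-- `G` is an interval graph: each vertex can be assigned a closed real interval so that
distinct vertices are adjacent iff their intervals intersect. -/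
def IsIntervalGraph {V : Type*} (G : SimpleGraph V) : Prop :=
  ∃ I : V → Set ℝ,
    (∀ v, ∃ a b : ℝ, a ≤ b ∧ I v = Set.Icc a b) ∧
    ∀ u v : V, u ≠ v → (G.Adj u v ↔ (I u ∩ I v).Nonempty)

section Orderings

variable {V : Type*} [Finite V]

/-- An interval ordering: for `u <σ v <σ w`, `uw ∈ E` implies `uv ∈ E`. -/
def IsIntervalOrdering (G : SimpleGraph V) (σ : V ≃ Fin (Nat.card V)) : Prop :=
  ∀ u v w : V, σ u < σ v → σ v < σ w → G.Adj u w → G.Adj u v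

/-- An umbrella ordering: for `u <σ v <σ w`, `uw ∈ E` iff `uv ∈ E` and `vw ∈ E`. -/
def IsUmbrellaOrdering (G : SimpleGraph V) (σ : V ≃ Fin (Nat.card V)) : Prop :=
  ∀ u v w : V, σ u < σ v → σ v < σ w → (G.Adj u w ↔ G.Adj u v ∧ G.Adj v w)

/-- A unit interval graph: a graph admitting an umbrella ordering. -/
def IsUnitIntervalGraph (G : SimpleGraph V) : Prop :=
  ∃ σ : V ≃ Fin (Nat.card V), IsUmbrellaOrdering G σ

/-- An LBFS ordering: for all `a <σ b <σ c` with `ac ∈ E` and `ab ∉ E` there is `d <σ a`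
with `db ∈ E` and `dc ∉ E`. -/
def IsLBFSOrdering (G : SimpleGraph V) (σ : V ≃ Fin (Nat.card V)) : Prop :=
  ∀ a b c : V, σ a < σ b → σ b < σ c → G.Adj a c → ¬ G.Adj a b →
    ∃ d : V, σ d < σ a ∧ G.Adj d b ∧ ¬ G.Adj d c

/-- An end vertex: the last vertex of some LBFS ordering. -/
def IsEndVertex (G : SimpleGraph V) (v : V) : Prop :=
  ∃ σ : V ≃ Fin (Nat.card V), IsLBFSOrdering G σ ∧ ∀ u, σ u ≤ σ v

/-- `N_σ(v)`: the neighbors of `v` preceding `v` in `σ`. -/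
def earlyNbhd (G : SimpleGraph V) (σ : V ≃ Fin (Nat.card V)) (v : V) : Set V :=
  {u | σ u < σ v ∧ G.Adj u v}

/-- The snapshot `S_σ(v)`: vertices `w` not before `v` whose neighborhood among the
vertices preceding `v` equals `N_σ(v)`. -/
def snapshot (G : SimpleGraph V) (σ : V ≃ Fin (Nat.card V)) (v : V) : Set V :=
  {w | σ v ≤ σ w ∧ {u | σ u < σ v ∧ G.Adj u w} = earlyNbhd G σ v}

/-- `τ = LBFS⁺(G, σ)`: `τ` is an LBFS ordering and every vertex is the `σ`-last vertex of
its own `τ`-snapshot. -/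
def IsLBFSPlusOf (G : SimpleGraph V) (σ τ : V ≃ Fin (Nat.card V)) : Prop :=
  IsLBFSOrdering G τ ∧ ∀ v w : V, w ∈ snapshot G τ v → σ w ≤ σ v

/-- `v` is exposed from the snapshot `S_σ(x)` in `σ`:
`v ∈ S_σ(x)` and `N(v) \ (N_σ(S) ∪ S) ≠ ∅`. -/
def ExposedFrom (G : SimpleGraph V) (σ : V ≃ Fin (Nat.card V)) (x v : V) : Prop :=
  v ∈ snapshot G σ x ∧
    (G.neighborSet v \ (earlyNbhd G σ x ∪ snapshot G σ x)).Nonempty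

/-- `x` is an end vertex of the subgraph of `G` induced by `S`. -/
def IsEndVertexOn (G : SimpleGraph V) (S : Set V) (x : V) : Prop :=
  ∃ hx : x ∈ S, IsEndVertex (G.induce S) ⟨x, hx⟩

/-- A well-anchored LBFS ordering: each snapshot starts from an exposed vertex if
one exists, and from an end vertex of the induced subgraph otherwise. -/
def IsWellAnchored (G : SimpleGraph V) (σ : V ≃ Fin (Nat.card V)) : Prop :=
  IsLBFSOrdering G σ ∧ ∀ x : V,
    ((∃ v, ExposedFrom G σ x v) → ExposedFrom G σ x x) ∧
    (¬ (∃ v, ExposedFrom G σ x v) → IsEndVertexOn G (snapshot G σ x) x)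

/-- An MCS ordering: each vertex has at least as many earlier neighbors as any
later vertex has among the vertices before it. -/
def IsMCSOrdering (G : SimpleGraph V) (σ : V ≃ Fin (Nat.card V)) : Prop :=
  ∀ v w : V, σ v < σ w →
    {u | σ u < σ v ∧ G.Adj u w}.ncard ≤ (earlyNbhd G σ v).ncard

end Orderings

section CliquePaths

variable {V : Type*}

/-- A clique path: an injective enumeration of all maximal cliques of `G` such that
for each vertex the set of indices of cliques containing it is a nonempty interval. -/
structure IsCliquePath (G : SimpleGraph V) {ℓ : ℕ} (K : Fin ℓ → Finset V) : Prop where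
  injective : Function.Injective K
  maxClique : ∀ i, Maximal G.IsClique (K i : Set V)
  complete : ∀ s : Set V, Maximal G.IsClique s → ∃ i, (K i : Set V) = s
  covers : ∀ v : V, ∃ i, v ∈ K i
  consecutive : ∀ (v : V) (i j k : Fin ℓ), i ≤ j → j ≤ k → v ∈ K i → v ∈ K k → v ∈ K j

/-- `i` is `lp(v)`: the smallest index of a clique containing `v`. -/
def IsLp {ℓ : ℕ} (K : Fin ℓ → Finset V) (v : V) (i : Fin ℓ) : Prop :=
  v ∈ K i ∧ ∀ j, v ∈ K j → i ≤ j

/-- `i` is `rp(v)`: the largest index of a clique containing `v`. -/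
def IsRp {ℓ : ℕ} (K : Fin ℓ → Finset V) (v : V) (i : Fin ℓ) : Prop :=
  v ∈ K i ∧ ∀ j, v ∈ K j → j ≤ i

/-- An ordering is consistent with a clique path if `u <σ v` whenever `lp(u) < lp(v)`. -/
def ConsistentWith [Finite V] {ℓ : ℕ} (σ : V ≃ Fin (Nat.card V))
    (K : Fin ℓ → Finset V) : Prop :=
  ∀ (u v : V) (iu iv : Fin ℓ), IsLp K u iu → IsLp K v iv → iu < iv → σ u < σ v

/-- A simplicial vertex: its closed neighborhood is a clique. -/
def IsSimplicial (G : SimpleGraph V) (v : V) : Prop :=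
  G.IsClique (insert v (G.neighborSet v))

/-- A module of `G`: every outside vertex is adjacent to all of `M` or to none of `M`. -/
def IsGraphModule (G : SimpleGraph V) (M : Set V) : Prop :=
  ∀ x ∉ M, (∀ v ∈ M, G.Adj x v) ∨ (∀ v ∈ M, ¬ G.Adj x v)

/-- True twins: adjacent vertices with the same closed neighborhood. -/
def AreTrueTwins (G : SimpleGraph V) (u v : V) : Prop :=
  G.Adj u v ∧ insert u (G.neighborSet u) = insert v (G.neighborSet v)

end CliquePaths

namespace IsCliquePath

variable {V : Type*} {G : SimpleGraph V} {ℓ : ℕ} {K : Fin ℓ → Finset V}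

/-- Adjacent vertices lie in a common clique of a clique path. -/
theorem exists_mem_of_adj [Finite V] (hK : IsCliquePath G K) {u v : V} (h : G.Adj u v) :
    ∃ i, u ∈ K i ∧ v ∈ K i := by
  have hc : G.IsClique {u, v} := SimpleGraph.isClique_pair.2 fun _ => h
  obtain ⟨s, hs, hmax⟩ := (Set.toFinite {s | G.IsClique s}).exists_le_maximal hc
  obtain ⟨i, rfl⟩ := hK.complete s hmax
  exact ⟨i, hs (by simp), hs (by simp)⟩

/-- Distinct vertices in a common clique of a clique path are adjacent. -/
theorem adj_of_mem (hK : IsCliquePath G K) {i : Fin ℓ} {u v : V} (hu : u ∈ K i) (hv : v ∈ K i)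
    (huv : u ≠ v) : G.Adj u v :=
  (hK.maxClique i).prop hu hv huv

/-- No clique of a clique path is contained in another one. -/
theorem exists_mem_notMem (hK : IsCliquePath G K) {i j : Fin ℓ} (hij : i ≠ j) :
    ∃ v ∈ K i, v ∉ K j := by
  by_contra! h
  refine hij (hK.injective (Finset.coe_injective ?_))
  exact (hK.maxClique i).eq_of_subset (hK.maxClique j).prop h

end IsCliquePath

/-- If every `K j` with `j ∈ X` contains `S`, and every vertex of a clique inside `X` that also
lies in a clique outside `X` belongs to `S`, then `⋃ j ∈ X, K j` without `S` is a module. -/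
theorem IsCliquePath.isGraphModule_iUnion_diff {V : Type*} [Finite V] {G : SimpleGraph V} {ℓ : ℕ}
    {K : Fin ℓ → Finset V} (hK : IsCliquePath G K) {X : Set (Fin ℓ)} {S : Set V}
    (hS : ∀ v ∈ S, ∀ j ∈ X, v ∈ K j)
    (hX : ∀ v, ∀ j ∈ X, ∀ i ∉ X, v ∈ K j → v ∈ K i → v ∈ S) :
    IsGraphModule G ((⋃ j ∈ X, (K j : Set V)) \ S) := by
  intro x hx
  by_cases hxS : x ∈ S
  · refine Or.inl fun u ⟨hu, huS⟩ => ?_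
    obtain ⟨j, hj, huj⟩ := Set.mem_iUnion₂.1 hu
    exact hK.adj_of_mem (hS x hxS j hj) huj fun h => huS (h ▸ hxS)
  · refine Or.inr fun u ⟨hu, huS⟩ hadj => ?_
    obtain ⟨j, hj, huj⟩ := Set.mem_iUnion₂.1 hu
    obtain ⟨i, hxi, hui⟩ := hK.exists_mem_of_adj hadj
    have hi : i ∈ X := by
      by_contra hi
      exact huS (hX u j hj i hi huj hui)
    exact hx ⟨Set.mem_iUnion₂.2 ⟨i, hi, hxi⟩, hxS⟩

/-- given two different clique paths `K` and `K ∘ b` of an interval graph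
with `ℓ + 1` maximal cliques, if (one-based) indices `p < q < ℓ + 1` satisfy that
`K (b p)` is the first clique and `K (b q)` is the last clique of the first path, then
`(⋃_{j ≥ b(last)} K j ∪ ⋃_{i ≥ q} K (b i)) \ (K (b last) ∩ K last)` is a nontrivial
module of `G`. -/
theorem two_clique_paths_give_nontrivial_module {V : Type*} [Finite V]
    (G : SimpleGraph V) (hG : IsIntervalGraph G)
    {ℓ : ℕ} (K : Fin (ℓ + 1) → Finset V) (b : Equiv.Perm (Fin (ℓ + 1)))
    (hK : IsCliquePath G K) (hKb : IsCliquePath G (K ∘ ⇑b))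
    (hne : K ∘ ⇑b ≠ K)
    (p q : Fin (ℓ + 1)) (hpq : p < q) (hq : q < Fin.last ℓ)
    (hbp : b p = 0) (hbq : b q = Fin.last ℓ) :
    ∀ U : Set V,
      U = ((⋃ j ∈ {j : Fin (ℓ + 1) | b (Fin.last ℓ) ≤ j}, (K j : Set V)) ∪
            ⋃ i ∈ {i : Fin (ℓ + 1) | q ≤ i}, (K (b i) : Set V)) \
          ((K (b (Fin.last ℓ)) : Set V) ∩ (K (Fin.last ℓ) : Set V)) →
      IsGraphModule G U ∧ U.Nontrivial ∧ U ≠ Set.univ := by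
  rintro U rfl
  set m := b (Fin.last ℓ) with hm
  have hml : m ≠ Fin.last ℓ := fun h => hq.ne (b.injective (hbq.trans h.symm))
  have hm0 : m ≠ 0 := fun h => (hpq.trans hq).ne (b.injective (hbp.trans h.symm))
  have consec : ∀ v i j k, i ≤ j → j ≤ k → v ∈ K (b i) → v ∈ K (b k) → v ∈ K (b j) :=
    hKb.consecutive
  let X : Set (Fin (ℓ + 1)) := {j | m ≤ j ∨ q ≤ b.symm j}
  have hUX : ((⋃ j ∈ {j : Fin (ℓ + 1) | m ≤ j}, (K j : Set V)) ∪
      ⋃ i ∈ {i : Fin (ℓ + 1) | q ≤ i}, (K (b i) : Set V)) = ⋃ j ∈ X, (K j : Set V) := by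
    ext v
    simp only [Set.mem_union, Set.mem_iUnion₂, Set.mem_ofPred_eq, exists_prop, X]
    constructor
    · rintro (⟨j, hj, hv⟩ | ⟨i, hi, hv⟩)
      · exact ⟨j, Or.inl hj, hv⟩
      · exact ⟨b i, Or.inr (by simpa using hi), hv⟩
    · rintro ⟨j, hj | hj, hv⟩
      · exact Or.inl ⟨j, hj, hv⟩
      · exact Or.inr ⟨b.symm j, hj, by simpa using hv⟩
  rw [hUX]
  have hS : ∀ v ∈ (K m : Set V) ∩ (K (Fin.last ℓ) : Set V), ∀ j ∈ X, v ∈ K j := by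
    rintro v ⟨hvm, hvl⟩ j (hj | hj)
    · exact hK.consecutive v m j (Fin.last ℓ) hj (Fin.le_last j) hvm hvl
    · simpa using consec v q (b.symm j) (Fin.last ℓ) hj (Fin.le_last _) (hbq ▸ hvl) hvm
  have hX : ∀ v, ∀ j ∈ X, ∀ i ∉ X, v ∈ K j → v ∈ K i →
      v ∈ (K m : Set V) ∩ (K (Fin.last ℓ) : Set V) := by
    intro v j hj i hi hvj hvi
    obtain ⟨him, hiq⟩ : i < m ∧ b.symm i < q := by simpa [X] using hi
    have hvi' : v ∈ K (b (b.symm i)) := by simpa using hvi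
    rcases hj with hj | hj
    · have hvm : v ∈ K m := hK.consecutive v i m j him.le hj hvi hvj
      exact ⟨hvm, hbq ▸ consec v (b.symm i) q (Fin.last ℓ) hiq.le hq.le hvi' hvm⟩
    · have hvl : v ∈ K (Fin.last ℓ) :=
        hbq ▸ consec v (b.symm i) q (b.symm j) hiq.le hj hvi' (by simpa using hvj)
      exact ⟨hK.consecutive v i m (Fin.last ℓ) him.le (Fin.le_last m) hvi hvl, hvl⟩
  refine ⟨hK.isGraphModule_iUnion_diff hS hX, ?_, ?_⟩
  · obtain ⟨x, hxm, hxl⟩ := hK.exists_mem_notMem hml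
    obtain ⟨y, hyl, hym⟩ := hK.exists_mem_notMem hml.symm
    exact ⟨x, ⟨Set.mem_iUnion₂.2 ⟨m, Or.inl le_rfl, hxm⟩, fun h => hxl h.2⟩,
      y, ⟨Set.mem_iUnion₂.2 ⟨Fin.last ℓ, Or.inl (Fin.le_last m), hyl⟩, fun h => hym h.1⟩,
      fun h => hxl (h ▸ hyl)⟩
  · intro huniv
    obtain ⟨x, hx0, hxm⟩ := hK.exists_mem_notMem hm0.symm
    obtain ⟨hxU, -⟩ := huniv.symm ▸ Set.mem_univ x
    obtain ⟨j, hj, hxj⟩ := Set.mem_iUnion₂.1 hxU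
    have h0 : (0 : Fin (ℓ + 1)) ∉ X := by
      rintro (h | h)
      · exact hm0 (Fin.le_zero_iff.1 h)
      · rw [← hbp, Equiv.symm_apply_apply] at h
        exact hpq.not_ge h
    exact hxm (hX x j hj 0 h0 hxj hx0).1
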